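/- arXiv:1302.5868 — 2 statements merged into one kernel-verified Lean document; each statement's English description precedes it below -/
import Mathlib

section
/- Gradient–entropy implies Harnack: suppose P is a Markov operator on ℬ_b(ℝ) such that for all positive bounded measurable f and all δ > 0, |∇ P f| ≤ δ[P(f log f) - (Pf) log Pf] + (C/δ) Pf holds; then for each p > 1 and all x, y ∈ ℝ, (Pf(x))^p ≤ P f^p(y) exp( (p/(p-1)) C |x-y|² ). -/
open MeasureTheory Real

lemma aux_exp_bound (x : ℝ) : |Real.exp x - 1 - x| ≤ x ^ 2 * Real.exp |x| := by
  have h := Complex.norm_exp_sub_sum_le_norm_mul_exp (x : ℂ) 2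
  simp only [Finset.sum_range_succ, Finset.sum_range_zero] at h
  have e : Complex.exp (x : ℂ) - (0 + (x : ℂ) ^ 0 / (Nat.factorial 0 : ℂ)
      + (x : ℂ) ^ 1 / (Nat.factorial 1 : ℂ)) = ((Real.exp x - 1 - x : ℝ) : ℂ) := by
    push_cast
    simp
    ring
  rw [e, Complex.norm_real, Complex.norm_real, Real.norm_eq_abs, Real.norm_eq_abs, sq_abs] at h
  exact h

lemma aux_L {b L B : ℝ} (hb : 0 < b) (hB : 0 ≤ B) (hL : L ≤ B) :
    |Real.exp (b * L) * L| ≤ Real.exp (2 * b * B) / b := by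
  rw [abs_mul, abs_of_pos (Real.exp_pos _), le_div_iff₀ hb]
  have h1 : b * |L| ≤ Real.exp (b * |L|) := by linarith [Real.add_one_le_exp (b * |L|)]
  have h2 : b * L + b * |L| ≤ 2 * b * B := by
    rcases abs_cases L with ⟨h, _⟩ | ⟨h, _⟩ <;> rw [h] <;> nlinarith [mul_nonneg hb.le hB]
  calc Real.exp (b * L) * |L| * b = Real.exp (b * L) * (b * |L|) := by ring
    _ ≤ Real.exp (b * L) * Real.exp (b * |L|) := by gcongr
    _ = Real.exp (b * L + b * |L|) := (Real.exp_add _ _).symm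
    _ ≤ _ := Real.exp_le_exp.2 h2

lemma aux_L2 {b L B h : ℝ} (hb : 0 < b) (hB : 0 ≤ B) (hL : L ≤ B) (hh : |h| ≤ b / 2) :
    |Real.exp ((b + h) * L) - Real.exp (b * L) - h * (Real.exp (b * L) * L)|
      ≤ (Real.exp (2 * b * B) * (8 / b ^ 2)) * h ^ 2 := by
  have e : Real.exp ((b + h) * L) - Real.exp (b * L) - h * (Real.exp (b * L) * L)
      = Real.exp (b * L) * (Real.exp (h * L) - 1 - h * L) := by
    rw [add_mul, Real.exp_add]; ring
  rw [e, abs_mul, abs_of_pos (Real.exp_pos _)]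
  have h0 : (b / 2 * |L|) ^ 2 / 2 ≤ Real.exp (b / 2 * |L|) := by
    have := Real.quadratic_le_exp_of_nonneg (x := b / 2 * |L|) (by positivity)
    have : 0 ≤ b / 2 * |L| := by positivity
    linarith
  have hL2 : L ^ 2 ≤ 8 / b ^ 2 * Real.exp (b / 2 * |L|) := by
    rw [div_mul_eq_mul_div, le_div_iff₀ (by positivity)]
    have : (b / 2 * |L|) ^ 2 = b ^ 2 / 4 * L ^ 2 := by rw [mul_pow, sq_abs]; ring
    rw [this] at h0
    linarith
  have h2 : b * L + b / 2 * |L| + b / 2 * |L| ≤ 2 * b * B := by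
    rcases abs_cases L with ⟨h, _⟩ | ⟨h, _⟩ <;> rw [h] <;> nlinarith [mul_nonneg hb.le hB]
  have h3 : |h * L| ≤ b / 2 * |L| := by rw [abs_mul]; gcongr
  calc Real.exp (b * L) * |Real.exp (h * L) - 1 - h * L|
      ≤ Real.exp (b * L) * ((h * L) ^ 2 * Real.exp |h * L|) := by
        gcongr; exact aux_exp_bound _
    _ = Real.exp (b * L) * Real.exp |h * L| * h ^ 2 * L ^ 2 := by ring
    _ ≤ Real.exp (b * L) * Real.exp (b / 2 * |L|) * h ^ 2
          * (8 / b ^ 2 * Real.exp (b / 2 * |L|)) := by gcongr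
    _ = Real.exp (b * L + b / 2 * |L| + b / 2 * |L|) * (8 / b ^ 2) * h ^ 2 := by
        rw [Real.exp_add, Real.exp_add]; ring
    _ ≤ _ := by gcongr

lemma aux_int {ν : Measure ℝ} [IsProbabilityMeasure ν] {g : ℝ → ℝ} (hg : Measurable g)
    {K : ℝ} (hK : ∀ z, |g z| ≤ K) : Integrable g ν :=
  Integrable.of_bound hg.aestronglyMeasurable K (Filter.Eventually.of_forall hK)

lemma aux_diff (μ : ℝ → Measure ℝ) (hprob : ∀ x, IsProbabilityMeasure (μ x))
    (hdiff : ∀ f : ℝ → ℝ, Measurable f → (∀ z, 0 < f z) → (∃ M : ℝ, ∀ z, f z ≤ M) →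
      Differentiable ℝ (fun x => ∫ z, f z ∂(μ x)))
    {g : ℝ → ℝ} (hg : Measurable g) {K : ℝ} (hK : ∀ z, |g z| ≤ K) :
    Differentiable ℝ (fun x => ∫ z, g z ∂(μ x)) := by
  have h := hdiff (fun z => g z + (K + 1)) (hg.add_const _)
    (fun z => by have := (abs_le.1 (hK z)).1; linarith)
    ⟨K + (K + 1), fun z => by have := (abs_le.1 (hK z)).2; linarith⟩
  have e : (fun x => ∫ z, g z ∂(μ x)) = fun x => (∫ z, (g z + (K + 1)) ∂(μ x)) - (K + 1) := by
    funext x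
    have := hprob x
    rw [integral_add (aux_int hg hK) (integrable_const _)]
    simp
  rw [e]
  exact h.sub_const _

lemma aux_deriv (μ : ℝ → Measure ℝ) (hprob : ∀ x, IsProbabilityMeasure (μ x))
    (hdiff : ∀ f : ℝ → ℝ, Measurable f → (∀ z, 0 < f z) → (∃ M : ℝ, ∀ z, f z ≤ M) →
      Differentiable ℝ (fun x => ∫ z, f z ∂(μ x)))
    {l : ℝ → ℝ} (hl : Measurable l) {B : ℝ} (hB : 0 ≤ B) (hlB : ∀ z, l z ≤ B)
    (q : ℝ → ℝ) (v : ℝ) {b : ℝ} (hb : 0 < b) (hq : HasDerivAt q v b) :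
    HasDerivAt (fun c => ∫ z, Real.exp (c * l z) ∂(μ (q c)))
      ((∫ z, Real.exp (b * l z) * l z ∂(μ (q b)))
        + v * deriv (fun x => ∫ z, Real.exp (b * l z) ∂(μ x)) (q b)) b := by
  have bd : ∀ c : ℝ, 0 < c → ∀ z, |Real.exp (c * l z)| ≤ Real.exp (c * B) := fun c hc z => by
    rw [abs_of_pos (Real.exp_pos _)]
    exact Real.exp_le_exp.2 (mul_le_mul_of_nonneg_left (hlB z) hc.le)
  have me : ∀ c : ℝ, Measurable fun z => Real.exp (c * l z) := fun c =>
    Real.measurable_exp.comp (hl.const_mul c)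
  have bd' := fun z => aux_L hb hB (hlB z)
  have me' : Measurable fun z => Real.exp (b * l z) * l z := (me b).mul hl
  have dG := aux_diff μ hprob hdiff (me b) (bd b hb)
  have dH := aux_diff μ hprob hdiff me' bd'
  have d1 : HasDerivAt (fun c => ∫ z, Real.exp (b * l z) ∂(μ (q c)))
      (deriv (fun x => ∫ z, Real.exp (b * l z) ∂(μ x)) (q b) * v) b :=
    HasDerivAt.comp b (dG (q b)).hasDerivAt hq
  have d2 : HasDerivAt (fun c => ∫ z, Real.exp (b * l z) * l z ∂(μ (q c)))
      (deriv (fun x => ∫ z, Real.exp (b * l z) * l z ∂(μ x)) (q b) * v) b :=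
    HasDerivAt.comp b (dH (q b)).hasDerivAt hq
  have d3 := ((hasDerivAt_id b).sub_const b).mul d2
  have d4 : HasDerivAt (fun c => (∫ z, Real.exp (c * l z) ∂(μ (q c)))
      - (∫ z, Real.exp (b * l z) ∂(μ (q c)))
      - (c - b) * (∫ z, Real.exp (b * l z) * l z ∂(μ (q c)))) 0 b := by
    rw [hasDerivAt_iff_isLittleO]
    have hO : (fun c => (c - b) ^ 2) =o[nhds b] fun c => c - b := by
      have : Filter.Tendsto (fun c : ℝ => c - b) (nhds b) (nhds 0) := by
        have : Continuous fun c : ℝ => c - b := by fun_prop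
        simpa using this.tendsto b
      exact (Asymptotics.isLittleO_pow_id (one_lt_two)).comp_tendsto this
    refine Asymptotics.IsBigO.trans_isLittleO ?_ hO
    refine Asymptotics.IsBigO.of_bound (Real.exp (2 * b * B) * (8 / b ^ 2)) ?_
    filter_upwards [Metric.closedBall_mem_nhds b (half_pos hb)] with c hc
    rw [Metric.mem_closedBall, Real.dist_eq] at hc
    have hc0 : 0 < c := by have := (abs_le.1 hc).1; linarith
    have := hprob (q c)
    have i1 := aux_int (ν := μ (q c)) (me c) (bd c hc0)
    have i2 := aux_int (ν := μ (q c)) (me b) (bd b hb)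
    have i3 := (aux_int (ν := μ (q c)) me' bd').const_mul (c - b)
    simp only [sub_self, zero_mul, sub_zero, smul_zero]
    have i4 : Integrable (fun z => Real.exp (c * l z) - Real.exp (b * l z)) (μ (q c)) := i1.sub i2
    rw [← integral_const_mul, ← integral_sub i1 i2, ← integral_sub i4 i3]
    rw [Real.norm_of_nonneg (sq_nonneg (c - b))]
    have key := norm_integral_le_of_norm_le_const (μ := μ (q c))
      (f := fun z => Real.exp (c * l z) - Real.exp (b * l z) - (c - b) * (Real.exp (b * l z) * l z))
      (C := (Real.exp (2 * b * B) * (8 / b ^ 2)) * (c - b) ^ 2)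
      (Filter.Eventually.of_forall fun z => by
        have := aux_L2 hb hB (hlB z) hc
        rw [add_sub_cancel] at this
        exact this)
    simpa using key
  have d5 := (d1.add d3).add d4
  refine (d5.congr_deriv ?_).congr_of_eventuallyEq (Filter.Eventually.of_forall fun c => ?_)
  · simp only [id, sub_self]
    ring
  · simp only [Pi.add_apply, Pi.mul_apply, id]
    ring

/-- Gradient–entropy estimate implies Harnack inequality: if
`|∇_v Pf(x)| ≤ δ[P(f log f)(x) - (Pf)(x) log Pf(x)] + (C/δ)|v|² Pf(x)` for all
positive bounded measurable `f`, all `δ > 0`, then for each `p > 1`,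
`(Pf(x))^p ≤ P f^p(y) exp((p/(p-1)) C |x-y|²)`. -/
theorem stmt9 (μ : ℝ → Measure ℝ) (hprob : ∀ x, IsProbabilityMeasure (μ x))
    (C : ℝ) (hC : 0 < C)
    (hdiff : ∀ f : ℝ → ℝ, Measurable f → (∀ z, 0 < f z) → (∃ M : ℝ, ∀ z, f z ≤ M) →
      Differentiable ℝ (fun x => ∫ z, f z ∂(μ x)))
    (hgrad : ∀ f : ℝ → ℝ, Measurable f → (∀ z, 0 < f z) → (∃ M : ℝ, ∀ z, f z ≤ M) →
      ∀ δ : ℝ, 0 < δ → ∀ x v : ℝ,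
        |v * deriv (fun x => ∫ z, f z ∂(μ x)) x|
          ≤ δ * ((∫ z, f z * Real.log (f z) ∂(μ x))
                  - (∫ z, f z ∂(μ x)) * Real.log (∫ z, f z ∂(μ x)))
            + (C / δ) * v^2 * (∫ z, f z ∂(μ x))) :
    ∀ p : ℝ, 1 < p → ∀ f : ℝ → ℝ, Measurable f → (∀ z, 0 < f z) →
      (∃ M : ℝ, ∀ z, f z ≤ M) → ∀ x y : ℝ,
        (∫ z, f z ∂(μ x)) ^ p
          ≤ (∫ z, (f z) ^ p ∂(μ y)) * Real.exp ((p/(p-1)) * C * (x - y)^2) := by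
  intro p hp f hf hpos hM x y
  obtain ⟨M, hM⟩ := hM
  set l : ℝ → ℝ := fun z => Real.log (f z) with hldef
  have hl : Measurable l := Real.measurable_log.comp hf
  set B : ℝ := max 0 (Real.log M)
  have hB : 0 ≤ B := le_max_left _ _
  have hlB : ∀ z, l z ≤ B := fun z =>
    (Real.log_le_log (hpos z) (hM z)).trans (le_max_right _ _)
  have hp1 : 0 < p - 1 := by linarith
  set v : ℝ := (y - x) / (p - 1) with hv
  set q : ℝ → ℝ := fun b => x + (b - 1) * v with hqdef
  have hq : ∀ b, HasDerivAt q v b := fun b => by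
    have h := (((hasDerivAt_id b).sub_const 1).mul_const v).const_add x
    rw [one_mul] at h
    exact h
  have bd : ∀ c : ℝ, 0 < c → ∀ z, Real.exp (c * l z) ≤ Real.exp (c * B) := fun c hc z =>
    Real.exp_le_exp.2 (mul_le_mul_of_nonneg_left (hlB z) hc.le)
  have me : ∀ c : ℝ, Measurable fun z => Real.exp (c * l z) := fun c =>
    Real.measurable_exp.comp (hl.const_mul c)
  set A : ℝ → ℝ := fun c => ∫ z, Real.exp (c * l z) ∂(μ (q c)) with hA
  have Apos : ∀ c, 0 < c → 0 < A c := fun c hc => by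
    have := hprob (q c)
    exact integral_exp_pos (aux_int (me c) (K := Real.exp (c * B)) (fun z => by
      rw [abs_of_pos (Real.exp_pos _)]; exact bd c hc z))
  have dA := fun b (hb : 0 < b) => aux_deriv μ hprob hdiff hl hB hlB q v hb (hq b)
  have dpsi : ∀ b, 0 < b → ∃ D, HasDerivAt (fun c => Real.log (A c) / c) D b ∧ -(C * v ^ 2) ≤ D := by
    intro b hb
    have d := ((dA b hb).log (Apos b hb).ne').div (hasDerivAt_id b) hb.ne'
    refine ⟨_, d, ?_⟩
    have g := hgrad (fun z => Real.exp (b * l z)) (me b) (fun z => Real.exp_pos _) ⟨_, bd b hb⟩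
      (1 / b) (by positivity) (q b) v
    simp only [Real.log_exp] at g
    have e : ∫ z, Real.exp (b * l z) * (b * l z) ∂(μ (q b))
        = b * ∫ z, Real.exp (b * l z) * l z ∂(μ (q b)) := by
      rw [← integral_const_mul]
      congr 1
      funext z
      ring
    rw [e] at g
    have hAb := Apos b hb
    change 0 < ∫ z, Real.exp (b * l z) ∂(μ (q b)) at hAb
    simp only [id]
    generalize (∫ z, Real.exp (b * l z) ∂(μ (q b))) = a at *
    generalize (∫ z, Real.exp (b * l z) * l z ∂(μ (q b))) = H at *
    generalize deriv (fun x => ∫ z, Real.exp (b * l z) ∂(μ x)) (q b) = D at *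
    have g2 := (abs_le.1 g).1
    have g3 : -(b * H - a * Real.log a) - C * b ^ 2 * v ^ 2 * a ≤ b * (v * D) := by
      have := mul_le_mul_of_nonneg_left g2 hb.le
      have e2 : b * -(1 / b * (b * H - a * Real.log a) + C / (1 / b) * v ^ 2 * a)
        = -(b * H - a * Real.log a) - C * b ^ 2 * v ^ 2 * a := by
        field_simp
        ring
      linarith
    have e3 : ((H + v * D) / a * b - Real.log a * 1) / b ^ 2
        = (b * H + b * (v * D) - a * Real.log a) / (a * b ^ 2) := by
      field_simp
    rw [e3, le_div_iff₀ (by positivity)]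
    linarith
  have mono : -(C * v ^ 2) * (p - 1) ≤ Real.log (A p) / p - Real.log (A 1) / 1 := by
    have hpos' : ∀ c ∈ Set.Icc 1 p, (0:ℝ) < c := fun c hc => lt_of_lt_of_le one_pos hc.1
    refine Convex.mul_sub_le_image_sub_of_le_deriv (f := fun c => Real.log (A c) / c)
      (convex_Icc 1 p) ?_ ?_ ?_ 1 (Set.left_mem_Icc.2 hp.le) p (Set.right_mem_Icc.2 hp.le) hp.le
    · intro c hc
      obtain ⟨D, hD, _⟩ := dpsi c (hpos' c hc)
      exact hD.continuousAt.continuousWithinAt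
    · intro c hc
      obtain ⟨D, hD, _⟩ := dpsi c (hpos' c (interior_subset hc))
      exact hD.differentiableAt.differentiableWithinAt
    · intro c hc
      obtain ⟨D, hD, h⟩ := dpsi c (hpos' c (interior_subset hc))
      rw [hD.deriv]
      exact h
  have q1 : q 1 = x := by simp [hqdef]
  have qp : q p = y := by
    simp only [hqdef, hv]
    field_simp
    ring
  have A1 : A 1 = ∫ z, f z ∂(μ x) := by
    simp only [hA, q1, hldef, one_mul, Real.exp_log (hpos _)]
  have Ap : A p = ∫ z, (f z) ^ p ∂(μ y) := by
    simp only [hA, qp, hldef]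
    congr 1
    funext z
    rw [Real.rpow_def_of_pos (hpos z), mul_comm]
  rw [← A1, ← Ap]
  have a1 := Apos 1 one_pos
  have p0 : 0 < p := by linarith
  have ap := Apos p p0
  rw [Real.rpow_def_of_pos a1]
  conv_rhs => rw [← Real.exp_log ap]
  rw [← Real.exp_add, Real.exp_le_exp]
  have h := mul_le_mul_of_nonneg_left mono p0.le
  have e1 : p * (Real.log (A p) / p - Real.log (A 1) / 1)
      = Real.log (A p) - Real.log (A 1) * p := by
    field_simp
  have e2 : p * (-(C * v ^ 2) * (p - 1)) = -(p / (p - 1) * C * (x - y) ^ 2) := by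
    rw [hv]
    field_simp
    ring
  rw [e1, e2] at h
  linarith
end

section
/- Harnack inequality implies log-Harnack inequality: if a Markov operator P on ℬ_b(ℝ) satisfies (Pf(x))^p ≤ P f^p(y) · exp( (p/(p-1)) C |x-y|² ) for all p > 1 and all non-negative bounded measurable f, then P(log f)(x) ≤ log Pf(y) + C|x-y|² for all positive bounded measurable f bounded away from 0. -/
open MeasureTheory Real

/-- Harnack inequality implies log-Harnack inequality: if for all `p > 1` and all
nonnegative bounded measurable `f`,
`(Pf(x))^p ≤ P f^p(y) · exp((p/(p-1)) C |x-y|²)`, then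
`P(log f)(x) ≤ log Pf(y) + C|x-y|²` for all positive bounded measurable `f`
bounded away from `0`. -/
theorem stmt10 (μ : ℝ → Measure ℝ) (hprob : ∀ x, IsProbabilityMeasure (μ x))
    (C : ℝ) (hC : 0 < C)
    (harnack : ∀ p : ℝ, 1 < p → ∀ f : ℝ → ℝ, Measurable f → (∀ z, 0 ≤ f z) →
      (∃ M : ℝ, ∀ z, f z ≤ M) → ∀ x y : ℝ,
        (∫ z, f z ∂(μ x)) ^ p
          ≤ (∫ z, (f z) ^ p ∂(μ y)) * Real.exp ((p/(p-1)) * C * (x - y)^2)) :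
    ∀ f : ℝ → ℝ, Measurable f → (∃ c : ℝ, 0 < c ∧ ∀ z, c ≤ f z) →
      (∃ M : ℝ, ∀ z, f z ≤ M) → ∀ x y : ℝ,
        (∫ z, Real.log (f z) ∂(μ x)) ≤ Real.log (∫ z, f z ∂(μ y)) + C * (x - y)^2 := by
  intro f hf ⟨c, hc, hcf⟩ ⟨M, hM⟩ x y
  have hpos : ∀ z, 0 < f z := fun z => hc.trans_le (hcf z)
  have key : ∀ p : ℝ, 1 < p → (∫ z, Real.log (f z) ∂(μ x)) ≤
      Real.log (∫ z, f z ∂(μ y)) + (p/(p-1)) * C * (x - y)^2 := by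
    intro p hp
    have hp0 : 0 < p := by linarith
    have hip : 0 < p⁻¹ := inv_pos.mpr hp0
    have := hprob x
    have := hprob y
    have hgm : Measurable (fun z => f z ^ p⁻¹) := hf.pow_const _
    have hgle : ∀ z, f z ^ p⁻¹ ≤ M ^ p⁻¹ := fun z =>
      Real.rpow_le_rpow (hpos z).le (hM z) hip.le
    have hgge : ∀ z, c ^ p⁻¹ ≤ f z ^ p⁻¹ := fun z =>
      Real.rpow_le_rpow hc.le (hcf z) hip.le
    have hgpos : ∀ z, 0 < f z ^ p⁻¹ := fun z => Real.rpow_pos_of_pos (hpos z) _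
    have h := harnack p hp (fun z => f z ^ p⁻¹) hgm (fun z => (hgpos z).le) ⟨_, hgle⟩ x y
    have hpp : ∀ z, (f z ^ p⁻¹) ^ p = f z := fun z =>
      Real.rpow_inv_rpow (hpos z).le hp0.ne'
    simp only [hpp] at h
    have hgi : Integrable (fun z => f z ^ p⁻¹) (μ x) :=
      Integrable.of_bound hgm.aestronglyMeasurable (M ^ p⁻¹)
        (Filter.Eventually.of_forall fun z => by
          rw [Real.norm_eq_abs, abs_of_pos (hgpos z)]; exact hgle z)
    have hfi : Integrable f (μ y) :=
      Integrable.of_bound hf.aestronglyMeasurable M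
        (Filter.Eventually.of_forall fun z => by
          rw [Real.norm_eq_abs, abs_of_pos (hpos z)]; exact hM z)
    have hli : Integrable (fun z => Real.log (f z)) (μ x) := by
      refine Integrable.of_bound hf.log.aestronglyMeasurable (max |Real.log c| |Real.log M|)
        (Filter.Eventually.of_forall fun z => ?_)
      rw [Real.norm_eq_abs]
      exact abs_le_max_abs_abs (Real.log_le_log hc (hcf z)) (Real.log_le_log (hpos z) (hM z))
    have hm : 0 < ∫ z, f z ^ p⁻¹ ∂(μ x) := by
      have h1 := integral_mono (integrable_const (c ^ p⁻¹)) hgi hgge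
      simp at h1
      exact (Real.rpow_pos_of_pos hc _).trans_le h1
    have hfy : 0 < ∫ z, f z ∂(μ y) := by
      have h1 := integral_mono (integrable_const c) hfi hcf
      simp at h1
      exact hc.trans_le h1
    have hlog := Real.log_le_log (Real.rpow_pos_of_pos hm p) h
    rw [Real.log_rpow hm, Real.log_mul hfy.ne' (Real.exp_pos _).ne', Real.log_exp] at hlog
    set m := ∫ z, f z ^ p⁻¹ ∂(μ x) with hmdef
    have hJ : p⁻¹ * ∫ z, Real.log (f z) ∂(μ x) ≤ Real.log m := by
      have h1 : ∫ z, p⁻¹ * Real.log (f z) ∂(μ x)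
          ≤ ∫ z, (f z ^ p⁻¹ / m + (Real.log m - 1)) ∂(μ x) := by
        refine integral_mono (hli.const_mul _) ((hgi.div_const m).add (integrable_const _)) ?_
        intro z
        have h2 := Real.log_le_sub_one_of_pos (div_pos (hgpos z) hm)
        rw [Real.log_div (hgpos z).ne' hm.ne', Real.log_rpow (hpos z)] at h2
        change p⁻¹ * Real.log (f z) ≤ f z ^ p⁻¹ / m + (Real.log m - 1)
        linarith
      rw [integral_const_mul, integral_add (hgi.div_const m) (integrable_const _),
        integral_div, ← hmdef, div_self hm.ne'] at h1
      simp at h1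
      exact h1
    have h3 := mul_le_mul_of_nonneg_left hJ hp0.le
    rw [← mul_assoc, mul_inv_cancel₀ hp0.ne', one_mul] at h3
    linarith
  refine le_of_forall_pos_le_add fun ε hε => ?_
  have hK : 0 ≤ C * (x - y)^2 := by positivity
  set K := C * (x - y)^2 with hKdef
  have hq : 0 < (K + 1) / ε := by positivity
  have h := key (1 + (K + 1) / ε) (by linarith)
  rw [mul_assoc, ← hKdef] at h
  have h2 : (1 + (K + 1) / ε) / (1 + (K + 1) / ε - 1) * K ≤ K + ε := by
    rw [add_sub_cancel_left, add_div, div_self hq.ne', one_div_div, add_mul, one_mul,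
      div_mul_eq_mul_div, add_comm]
    have : ε * K / (K + 1) ≤ ε := by
      rw [div_le_iff₀ (by linarith)]
      nlinarith
    linarith
  linarith
end
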